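/- Let F be an Archimedean vector lattice and f ∈ F with f ≥ 0. The following are equivalent: (i) f belongs to the atomic part F_a of F, i.e., every g with 0 < g ≤ f dominates an atom of F; (ii) the order interval [0,f] is order pre-compact (every ultrafilter on F containing [0,f] is order Cauchy); (iii) order convergence on [0,f] is topological, i.e., there is a topology τ on the set [0,f] such that for every filter G on F containing [0,f] and every p ∈ [0,f], G order converges to p if and only if the trace of G on [0,f] contains the τ-neighborhood filter of p. -/

import Mathlib

/-- A filter `G` on a lattice order converges to `p` if it contains a family of
order intervals whose intersection equals `{p}`. -/
def OrderConvergesTo {F : Type*} [Lattice F] (G : Filter F) (p : F) : Prop :=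
  ∃ S : Set (F × F),
    (∀ q ∈ S, q.1 ≤ q.2) ∧
    (∀ q ∈ S, Set.Icc q.1 q.2 ∈ G) ∧
    (⋂ q ∈ S, Set.Icc q.1 q.2) = {p}

/-- A filter `G` is order Cauchy if the pushforward of `G ×ˢ G` under `(x, y) ↦ x - y`
order converges to `0`. -/
def OrderCauchy {F : Type*} [Lattice F] [AddCommGroup F] (G : Filter F) : Prop :=
  OrderConvergesTo (Filter.map (fun q : F × F => q.1 - q.2) (G ×ˢ G)) (0 : F)

/-- A subset `S` is order pre-compact if every ultrafilter containing `S` is order Cauchy. -/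
def OrderPreCompact {F : Type*} [Lattice F] [AddCommGroup F] (S : Set F) : Prop :=
  ∀ U : Ultrafilter F, S ∈ U → OrderCauchy (U : Filter F)

/-- An atom of a vector lattice: a positive element all of whose order-subelements are
scalar multiples of it. -/
def IsVLAtom {F : Type*} [Lattice F] [AddCommGroup F] [Module ℝ F] (a : F) : Prop :=
  0 < a ∧ ∀ b : F, 0 ≤ b → b ≤ a → ∃ t : ℝ, b = t • a

section VectorLattice

variable {F : Type*} [Lattice F] [AddCommGroup F]

theorem inf_eq_zero_of_le {a b c d : F} (ha : 0 ≤ a) (hb : 0 ≤ b) (hac : a ≤ c) (hbd : b ≤ d)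
    (h : c ⊓ d = 0) : a ⊓ b = 0 :=
  le_antisymm (h ▸ inf_le_inf hac hbd) (le_inf ha hb)

variable [IsOrderedAddMonoid F]

theorem inf_add_le_inf_add_inf {a b c : F} (ha : 0 ≤ a) (hb : 0 ≤ b) (hc : 0 ≤ c) :
    a ⊓ (b + c) ≤ a ⊓ b + a ⊓ c := by
  rw [add_inf, inf_add, inf_add]
  refine le_inf (le_inf ?_ ?_) (le_inf ?_ inf_le_right)
  · exact inf_le_left.trans (le_add_of_nonneg_left ha)
  · exact inf_le_left.trans (le_add_of_nonneg_left hb)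
  · exact inf_le_left.trans (le_add_of_nonneg_right hc)

theorem le_of_le_add_of_inf_eq_zero {a b c : F} (ha : 0 ≤ a) (hb : 0 ≤ b) (hc : 0 ≤ c)
    (h : a ≤ b + c) (hac : a ⊓ c = 0) : a ≤ b := by
  have := inf_add_le_inf_add_inf ha hb hc
  rw [inf_eq_left.2 h, hac, add_zero] at this
  exact this.trans inf_le_right

theorem add_le_of_inf_eq_zero {a b c : F} (h : a ⊓ b = 0) (ha : a ≤ c) (hb : b ≤ c) :
    a + b ≤ c := by
  rw [← inf_add_sup a b, h, zero_add]
  exact sup_le ha hb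

theorem inf_add_eq_zero {a b c : F} (ha : 0 ≤ a) (hb : 0 ≤ b) (hc : 0 ≤ c)
    (hab : a ⊓ b = 0) (hac : a ⊓ c = 0) : a ⊓ (b + c) = 0 := by
  refine le_antisymm ?_ (le_inf ha (add_nonneg hb hc))
  simpa [hab, hac] using inf_add_le_inf_add_inf ha hb hc

theorem inf_nsmul_eq_zero {a b : F} (ha : 0 ≤ a) (hb : 0 ≤ b) (hab : a ⊓ b = 0) (n : ℕ) :
    a ⊓ n • b = 0 := by
  induction n with
  | zero => simpa using ha
  | succ n ih =>
    rw [succ_nsmul]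
    exact inf_add_eq_zero ha (nsmul_nonneg hb n) hb ih hab

theorem inf_sum_eq_zero {ι : Type*} {p : ι → F} {a : F} (ha : 0 ≤ a) (s : Finset ι)
    (hp : ∀ i ∈ s, 0 ≤ p i) (h : ∀ i ∈ s, a ⊓ p i = 0) : a ⊓ ∑ i ∈ s, p i = 0 := by
  classical
  induction s using Finset.induction_on with
  | empty => simpa using ha
  | insert i s hi ih =>
    rw [Finset.sum_insert hi]
    simp only [Finset.mem_insert, forall_eq_or_imp] at hp h
    exact inf_add_eq_zero ha hp.1 (Finset.sum_nonneg hp.2) h.1 (ih hp.2 h.2)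

theorem sum_le_of_pairwise_disjoint {ι : Type*} {p : ι → F} {g : F} (hg : 0 ≤ g) (s : Finset ι)
    (hp : ∀ i ∈ s, 0 ≤ p i) (hle : ∀ i ∈ s, p i ≤ g)
    (hd : ∀ i ∈ s, ∀ j ∈ s, i ≠ j → p i ⊓ p j = 0) : ∑ i ∈ s, p i ≤ g := by
  classical
  induction s using Finset.induction_on with
  | empty => simpa using hg
  | insert a s ha ih =>
    have hs : s ⊆ insert a s := Finset.subset_insert a s
    have haI := Finset.mem_insert_self a s
    rw [Finset.sum_insert ha]
    refine add_le_of_inf_eq_zero (inf_sum_eq_zero (hp a haI) s (fun i hi => hp i (hs hi))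
      fun i hi => hd a haI i (hs hi) fun H => ha (H ▸ hi)) (hle a haI)
      (ih (fun i hi => hp i (hs hi)) (fun i hi => hle i (hs hi))
        fun i hi j hj => hd i (hs hi) j (hs hj))

theorem exists_nsmul_inf_not_le (harch : ∀ x y : F, 0 ≤ x → (∀ n : ℕ, n • x ≤ y) → x = 0)
    {g w k : F} (hg : 0 ≤ g) (hk : 0 < k) (hkw : k ≤ (g - w)⁺) :
    ∃ N : ℕ, ¬ (N • k ⊓ g ≤ w) := by
  by_contra! H
  refine hk.ne' (harch k g hk.le fun n => ?_)
  induction n with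
  | zero => simpa using hg
  | succ n ih =>
    have h1 : n • k ≤ w := by simpa [inf_eq_left.2 ih] using H n
    rw [succ_nsmul]
    have h2 : n • k + k ≤ (g ⊓ w) + (g - w)⁺ := add_le_add (le_inf ih h1) hkw
    have h3 : (g ⊓ w) + (g - w)⁺ = g := by
      rw [posPart_def, ← sub_self g, sup_comm, ← sub_inf, add_sub_cancel]
    exact h3 ▸ h2

/-- A disjoint order bounded sequence order converges to zero. -/
theorem orderConvergesTo_zero_of_disjoint_seq
    (harch : ∀ x y : F, 0 ≤ x → (∀ n : ℕ, n • x ≤ y) → x = 0)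
    {p : ℕ → F} {g : F} (hp : ∀ n, 0 ≤ p n) (hpg : ∀ n, p n ≤ g)
    (hd : ∀ i j, i ≠ j → p i ⊓ p j = 0) :
    OrderConvergesTo (Filter.map p Filter.atTop) 0 := by
  refine ⟨{q | q.1 = 0 ∧ 0 ≤ q.2 ∧ ∃ n, ∀ m ≥ n, p m ≤ q.2}, ?_, ?_, ?_⟩
  · rintro ⟨u, w⟩ ⟨rfl, hw, -⟩
    exact hw
  · rintro ⟨u, w⟩ ⟨rfl, hw, n, hn⟩
    exact Filter.mem_map.2 (Filter.mem_atTop_sets.2 ⟨n, fun m hm => ⟨hp m, hn m hm⟩⟩)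
  · ext z
    simp only [Set.mem_iInter, Set.mem_singleton_iff]
    refine ⟨fun hz => ?_, ?_⟩
    · have hg : 0 ≤ g := (hp 0).trans (hpg 0)
      have hzw : ∀ w, (∃ n, ∀ m ≥ n, p m ≤ w) → z ≤ w := fun w ⟨n, hn⟩ =>
        (hz (0, w) ⟨rfl, (hp n).trans (hn n le_rfl), n, hn⟩).2
      have hz0 : 0 ≤ z := (hz (0, g) ⟨rfl, hg, 0, fun m _ => hpg m⟩).1
      have key : ∀ y, 0 ≤ y → y ≤ z → (∃ n, ∀ m ≥ n, p m ⊓ y = 0) → y = 0 := by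
        rintro y hy hyz ⟨n, hn⟩
        refine harch y g hy fun N => ?_
        induction N with
        | zero => simpa using hg
        | succ N ih =>
          have : z ≤ g - N • y := hzw _ ⟨n, fun m hm => le_sub_iff_add_le.2
            (add_le_of_inf_eq_zero (inf_nsmul_eq_zero (hp m) hy (hn m hm) N) (hpg m) ih)⟩
          rw [succ_nsmul]
          exact le_sub_iff_add_le'.1 (hyz.trans this)
      refine key z hz0 le_rfl ⟨0, fun m _ => ?_⟩
      refine key _ (le_inf (hp m) hz0) inf_le_right ⟨m + 1, fun j hj => ?_⟩
      exact inf_eq_zero_of_le (hp j) (le_inf (hp m) hz0) le_rfl inf_le_left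
        (hd j m (by omega))
    · rintro rfl ⟨u, w⟩ ⟨rfl, hw, -⟩
      exact ⟨le_rfl, hw⟩

variable [Module ℝ F] [PosSMulMono ℝ F]

theorem smul_le_smul_right_of_nonneg {a : F} (ha : 0 ≤ a) {s t : ℝ} (h : s ≤ t) :
    s • a ≤ t • a := by
  have := smul_nonneg (sub_nonneg.2 h) ha
  rwa [sub_smul, sub_nonneg] at this

theorem eq_zero_of_forall_le_inv_smul
    (harch : ∀ x y : F, 0 ≤ x → (∀ n : ℕ, n • x ≤ y) → x = 0)
    {a x : F} (hx : 0 ≤ x) (h : ∀ n : ℕ, x ≤ ((n : ℝ) + 1)⁻¹ • a) : x = 0 := by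
  refine harch x a hx fun n => ?_
  have hn : (0 : ℝ) < n + 1 := by positivity
  have h1 : ((n : ℝ) + 1) • x ≤ a := by
    have := smul_le_smul_of_nonneg_left (h n) hn.le
    rwa [smul_smul, mul_inv_cancel₀ hn.ne', one_smul] at this
  rw [← Nat.cast_smul_eq_nsmul ℝ]
  exact (smul_le_smul_right_of_nonneg hx (by linarith)).trans h1

theorem exists_greatest_smul_le
    (harch : ∀ x y : F, 0 ≤ x → (∀ n : ℕ, n • x ≤ y) → x = 0)
    {a x : F} (ha : 0 < a) (hx : 0 ≤ x) :
    ∃ s : ℝ, 0 ≤ s ∧ s • a ≤ x ∧ ∀ t : ℝ, t • a ≤ x → t ≤ s := by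
  set T : Set ℝ := {t | t • a ≤ x}
  have h0 : (0 : ℝ) ∈ T := by simpa [T] using hx
  have hbdd : BddAbove T := by
    by_contra H
    rw [not_bddAbove_iff] at H
    refine ha.ne' (harch a x ha.le fun n => ?_)
    obtain ⟨t, ht, hnt⟩ := H n
    rw [← Nat.cast_smul_eq_nsmul ℝ]
    exact (smul_le_smul_right_of_nonneg ha.le hnt.le).trans ht
  refine ⟨sSup T, le_csSup hbdd h0, ?_, fun t ht => le_csSup hbdd ht⟩
  have : (sSup T • a - x)⁺ = 0 := by
    refine eq_zero_of_forall_le_inv_smul harch (a := a) (posPart_nonneg _) fun n => ?_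
    have hn : (0 : ℝ) < ((n : ℝ) + 1)⁻¹ := by positivity
    refine sup_le ?_ (smul_nonneg hn.le ha.le)
    obtain ⟨t, ht, hlt⟩ := exists_lt_of_lt_csSup ⟨0, h0⟩ (sub_lt_self (sSup T) hn)
    rw [sub_le_iff_le_add]
    refine (smul_le_smul_right_of_nonneg ha.le (t := ((n : ℝ) + 1)⁻¹ + t) (by linarith)).trans ?_
    rw [add_smul]
    exact add_le_add_right ht _
  rwa [posPart_eq_zero, sub_nonpos] at this

theorem exists_disjoint_of_not_isVLAtom
    (harch : ∀ x y : F, 0 ≤ x → (∀ n : ℕ, n • x ≤ y) → x = 0)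
    {h : F} (hh : 0 < h) (hna : ¬ IsVLAtom h) :
    ∃ u v : F, 0 < u ∧ 0 < v ∧ u ≤ h ∧ v ≤ h ∧ u ⊓ v = 0 := by
  simp only [IsVLAtom, hh, true_and, not_forall, not_exists] at hna
  obtain ⟨b, hb0, hbh, hb⟩ := hna
  obtain ⟨s, hs0, hsb, hs⟩ := exists_greatest_smul_le harch hh hb0
  have hc0 : 0 < b - s • h :=
    lt_of_le_of_ne (sub_nonneg.2 hsb) fun H => hb s (sub_eq_zero.1 H.symm)
  set c := b - s • h
  have hch : c ≤ h := (sub_le_self b (smul_nonneg hs0 hh.le)).trans hbh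
  obtain ⟨n, hn⟩ : ∃ n : ℕ, ¬ c ≤ ((n : ℝ) + 1)⁻¹ • h := by
    by_contra! H
    exact hc0.ne' (eq_zero_of_forall_le_inv_smul harch hc0.le H)
  have ht : (0 : ℝ) < ((n : ℝ) + 1)⁻¹ := by positivity
  have ht1 : ((n : ℝ) + 1)⁻¹ ≤ 1 := inv_le_one_of_one_le₀ (by simp)
  set t := ((n : ℝ) + 1)⁻¹
  have hth : t • h ≤ h := by simpa using smul_le_smul_right_of_nonneg hh.le ht1
  have hnt : ¬ t • h ≤ c := fun H => by
    have h1 := hs (s + t) (by rw [add_smul]; exact le_sub_iff_add_le'.1 H)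
    linarith
  refine ⟨(c - t • h)⁺, (c - t • h)⁻, ?_, ?_, ?_, ?_, posPart_inf_negPart_eq_zero _⟩
  · refine lt_of_le_of_ne (posPart_nonneg _) fun H => hn ?_
    rwa [eq_comm, posPart_eq_zero, sub_nonpos] at H
  · refine lt_of_le_of_ne (negPart_nonneg _) fun H => hnt ?_
    rwa [eq_comm, negPart_eq_zero, sub_nonneg] at H
  · exact sup_le ((sub_le_self c (smul_nonneg ht.le hh.le)).trans hch) hh.le
  · rw [negPart_def, neg_sub]
    exact sup_le ((sub_le_self _ hc0.le).trans hth) hh.le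

theorem exists_pairwise_disjoint_le
    (harch : ∀ x y : F, 0 ≤ x → (∀ n : ℕ, n • x ≤ y) → x = 0)
    {g : F} (hg : ∀ a, IsVLAtom a → ¬ a ≤ g) {ι : Type*} (s : Finset ι) (h : ι → F)
    (h0 : ∀ i ∈ s, 0 < h i) (hle : ∀ i ∈ s, h i ≤ g) :
    ∃ k : ι → F, (∀ i ∈ s, 0 < k i ∧ k i ≤ h i) ∧
      ∀ i ∈ s, ∀ j ∈ s, i ≠ j → k i ⊓ k j = 0 := by
  classical
  induction s using Finset.induction_on with
  | empty => exact ⟨h, by simp, by simp⟩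
  | insert a s ha ih =>
    simp only [Finset.mem_insert, forall_eq_or_imp] at h0 hle
    obtain ⟨k, hk, hd⟩ := ih h0.2 hle.2
    by_cases H : ∀ i ∈ s, h a ⊓ k i = 0
    · refine ⟨Function.update k a (h a), fun i hi => ?_, fun i hi j hj hij => ?_⟩
      · rcases eq_or_ne i a with rfl | hia
        · simpa using h0.1
        · simpa [hia] using hk i (Finset.mem_of_mem_insert_of_ne hi hia)
      · rcases eq_or_ne i a with rfl | hia
        · have hj' := Finset.mem_of_mem_insert_of_ne hj hij.symm
          simpa [hij.symm] using H j hj'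
        · have hi' := Finset.mem_of_mem_insert_of_ne hi hia
          rcases eq_or_ne j a with rfl | hja
          · simpa [hij, inf_comm] using H i hi'
          · simpa [hia, hja] using hd i hi' j (Finset.mem_of_mem_insert_of_ne hj hja) hij
    · push Not at H
      obtain ⟨b, hb, hab⟩ := H
      have hpos : 0 < h a ⊓ k b := lt_of_le_of_ne (le_inf h0.1.le (hk b hb).1.le) hab.symm
      obtain ⟨u, v, hu, hv, huh, hvh, huv⟩ := exists_disjoint_of_not_isVLAtom harch hpos
        fun H => hg _ H (inf_le_left.trans hle.1)
      have hba : b ≠ a := fun H => ha (H ▸ hb)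
      have huk : u ≤ k b := huh.trans inf_le_right
      have hvk : v ≤ k b := hvh.trans inf_le_right
      have key : ∀ j ∈ s, j ≠ b → u ⊓ k j = 0 ∧ v ⊓ k j = 0 := fun j hj hjb =>
        ⟨inf_eq_zero_of_le hu.le (hk j hj).1.le huk le_rfl (hd b hb j hj hjb.symm),
          inf_eq_zero_of_le hv.le (hk j hj).1.le hvk le_rfl (hd b hb j hj hjb.symm)⟩
      refine ⟨Function.update (Function.update k b u) a v, fun i hi => ?_,
        fun i hi j hj hij => ?_⟩
      · rcases eq_or_ne i a with rfl | hia
        · simpa using ⟨hv, hvh.trans inf_le_left⟩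
        · have hi' := Finset.mem_of_mem_insert_of_ne hi hia
          rcases eq_or_ne i b with rfl | hib
          · simpa [hia] using ⟨hu, huk.trans (hk i hb).2⟩
          · simpa [hia, hib] using hk i hi'
      · rcases eq_or_ne i a with rfl | hia
        · have hj' := Finset.mem_of_mem_insert_of_ne hj hij.symm
          rcases eq_or_ne j b with rfl | hjb
          · simpa [hba, inf_comm] using huv
          · simpa [hij.symm, hjb] using (key j hj' hjb).2
        · have hi' := Finset.mem_of_mem_insert_of_ne hi hia
          rcases eq_or_ne j a with rfl | hja
          · rcases eq_or_ne i b with rfl | hib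
            · simpa [hba] using huv
            · simpa [hij, hib, inf_comm] using (key i hi' hib).2
          · have hj' := Finset.mem_of_mem_insert_of_ne hj hja
            rcases eq_or_ne i b with rfl | hib
            · simpa [hia, hja, hij.symm] using (key j hj' hij.symm).1
            · rcases eq_or_ne j b with rfl | hjb
              · simpa [hia, hja, hij, inf_comm] using (key i hi' hij).1
              · simpa [hia, hja, hib, hjb] using hd i hi' j hj' hij

theorem exists_seq_disjoint_le
    (harch : ∀ x y : F, 0 ≤ x → (∀ n : ℕ, n • x ≤ y) → x = 0)
    {h : F} (hh : 0 < h) (hna : ∀ a, IsVLAtom a → ¬ a ≤ h) :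
    ∃ k : ℕ → F, (∀ n, 0 < k n ∧ k n ≤ h) ∧ ∀ i j, i ≠ j → k i ⊓ k j = 0 := by
  have split : ∀ x : {x : F // 0 < x ∧ x ≤ h}, ∃ y : F × {x : F // 0 < x ∧ x ≤ h},
      0 < y.1 ∧ y.1 ≤ x ∧ (y.2 : F) ≤ x ∧ y.1 ⊓ y.2 = 0 := by
    rintro ⟨x, hx, hxh⟩
    obtain ⟨u, v, hu, hv, hux, hvx, huv⟩ := exists_disjoint_of_not_isVLAtom harch hx
      fun H => hna _ H hxh
    exact ⟨(u, ⟨v, hv, hvx.trans hxh⟩), hu, hux, hvx, huv⟩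
  choose φ h0 h1 h2 h3 using split
  let r : ℕ → {x : F // 0 < x ∧ x ≤ h} :=
    fun n => (fun x => (φ x).2)^[n] ⟨h, hh, le_rfl⟩
  have hr : ∀ n, r (n + 1) = (φ (r n)).2 := fun n => Function.iterate_succ_apply' _ _ _
  have hanti : Antitone fun n => (r n : F) :=
    antitone_nat_of_succ_le fun n => by rw [hr]; exact h2 _
  have hlt : ∀ i j, i < j → (φ (r i)).1 ⊓ (φ (r j)).1 = 0 := fun i j hij =>
    inf_eq_zero_of_le (h0 _).le (h0 _).le le_rfl
      (((h1 (r j)).trans (hanti (Nat.succ_le_of_lt hij))).trans (by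
        show (r (i + 1) : F) ≤ ((φ (r i)).2 : F)
        rw [hr])) (h3 _)
  refine ⟨fun n => (φ (r n)).1, fun n => ⟨h0 _, (h1 _).trans (r n).2.2⟩, fun i j hij => ?_⟩
  rcases lt_or_gt_of_ne hij with H | H
  · exact hlt i j H
  · rw [inf_comm]; exact hlt j i H

/-- `c` records on positive elements the coordinate along the band spanned by `a`. -/
def IsCoordAlong (a : F) (c : F → ℝ) : Prop :=
  ∀ x, 0 ≤ x → 0 ≤ c x ∧ c x • a ≤ x ∧ (x - c x • a) ⊓ a = 0

theorem IsVLAtom.exists_isCoordAlong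
    (harch : ∀ x y : F, 0 ≤ x → (∀ n : ℕ, n • x ≤ y) → x = 0)
    {a : F} (ha : IsVLAtom a) : ∃ c : F → ℝ, IsCoordAlong a c := by
  suffices ∀ x : F, ∃ s : ℝ, 0 ≤ x → 0 ≤ s ∧ s • a ≤ x ∧ (x - s • a) ⊓ a = 0 from
    ⟨fun x => (this x).choose, fun x => (this x).choose_spec⟩
  intro x
  by_cases hx : 0 ≤ x
  · obtain ⟨s, hs0, hsx, hs⟩ := exists_greatest_smul_le harch ha.1 hx
    refine ⟨s, fun _ => ⟨hs0, hsx, ?_⟩⟩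
    have hnn : 0 ≤ (x - s • a) ⊓ a := le_inf (sub_nonneg.2 hsx) ha.1.le
    refine le_antisymm ?_ hnn
    obtain ⟨t, ht⟩ := ha.2 _ hnn inf_le_right
    have h1 : t • a ≤ x - s • a := ht ▸ inf_le_left
    have h2 := hs (s + t) (by rw [add_smul]; exact le_sub_iff_add_le'.1 h1)
    rw [ht]
    simpa using smul_le_smul_right_of_nonneg ha.1.le (show t ≤ 0 by linarith)
  · exact ⟨0, fun h => absurd h hx⟩

theorem inf_smul_eq_zero {a x : F} (ha : 0 ≤ a) (hx : 0 ≤ x) (h : x ⊓ a = 0) {t : ℝ}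
    (ht : 0 ≤ t) : x ⊓ t • a = 0 := by
  obtain ⟨n, hn⟩ := exists_nat_ge t
  refine inf_eq_zero_of_le hx (smul_nonneg ht ha) le_rfl ?_ (inf_nsmul_eq_zero hx ha h n)
  rw [← Nat.cast_smul_eq_nsmul ℝ]
  exact smul_le_smul_right_of_nonneg ha hn

theorem IsCoordAlong.residual_mono {a : F} {c : F → ℝ} (hc : IsCoordAlong a c) (ha : 0 ≤ a)
    {x y : F} (hx : 0 ≤ x) (hxy : x ≤ y) : x - c x • a ≤ y - c y • a := by
  obtain ⟨hx0, hx1, hx2⟩ := hc x hx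
  obtain ⟨hy0, hy1, -⟩ := hc y (hx.trans hxy)
  refine le_of_le_add_of_inf_eq_zero (c := c y • a) (sub_nonneg.2 hx1) (sub_nonneg.2 hy1)
    (smul_nonneg hy0 ha) ?_ (inf_smul_eq_zero ha (sub_nonneg.2 hx1) hx2 hy0)
  rw [sub_add_cancel]
  exact (sub_le_self x (smul_nonneg hx0 ha)).trans hxy

theorem IsCoordAlong.mono {a : F} {c : F → ℝ} (hc : IsCoordAlong a c) (ha : 0 < a)
    {x y : F} (hx : 0 ≤ x) (hxy : x ≤ y) : c x ≤ c y := by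
  obtain ⟨-, hx1, -⟩ := hc x hx
  obtain ⟨-, hy1, hy2⟩ := hc y (hx.trans hxy)
  by_contra! H
  have hpos : 0 < c x - c y := sub_pos.2 H
  have h1 : (c x - c y) • a ≤ y - c y • a := by
    rw [sub_smul]
    exact sub_le_sub_right (hx1.trans hxy) _
  have h2 := inf_smul_eq_zero ha.le (sub_nonneg.2 hy1) hy2 hpos.le
  rw [inf_eq_right.2 h1, smul_eq_zero] at h2
  exact h2.elim hpos.ne' ha.ne'

theorem IsCoordAlong.sub_le {a : F} {c : F → ℝ} (hc : IsCoordAlong a c) (ha : 0 ≤ a)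
    {f x y : F} (hx : 0 ≤ x) (hxf : x ≤ f) (hy : 0 ≤ y) {ε : ℝ} (h : c x - c y ≤ ε) :
    x - y ≤ ε • a + (f - c f • a) := by
  have h1 : x - y = (c x - c y) • a + (x - c x • a) - (y - c y • a) := by
    rw [sub_smul]; abel
  rw [h1]
  exact (sub_le_self _ (sub_nonneg.2 (hc y hy).2.1)).trans
    (add_le_add (smul_le_smul_right_of_nonneg ha h) (hc.residual_mono ha hx hxf))

theorem IsCoordAlong.add_smul_le {a : F} {c : F → ℝ} (hc : IsCoordAlong a c) (ha : 0 ≤ a)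
    {x y : F} (hx : 0 ≤ x) (hxy : x ≤ y) {ε : ℝ} (h : c x + ε ≤ c y) :
    x + ε • a ≤ y := by
  have h1 : x + ε • a = (x - c x • a) + (c x + ε) • a := by rw [add_smul]; abel
  rw [h1, ← sub_add_cancel y (c y • a)]
  exact add_le_add (hc.residual_mono ha hx hxy) (smul_le_smul_right_of_nonneg ha h)

theorem eq_zero_of_forall_atom_le {f : F}
    (hat : ∀ g : F, 0 < g → g ≤ f → ∃ a : F, IsVLAtom a ∧ a ≤ g)
    {C : {a : F // IsVLAtom a} → F → ℝ} (hC : ∀ a, IsCoordAlong a.1 (C a)) {y : F}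
    (hy : 0 ≤ y) (hyf : y ≤ f)
    (h : ∀ a, y ≤ (1 / 2 : ℝ) • a.1 + (f - C a f • a.1)) : y = 0 := by
  by_contra hne
  obtain ⟨a, ha, hay⟩ := hat y (lt_of_le_of_ne hy (Ne.symm hne)) hyf
  obtain ⟨-, h1, h2⟩ := hC ⟨a, ha⟩ f (hy.trans hyf)
  have h3 : a ≤ (1 / 2 : ℝ) • a :=
    le_of_le_add_of_inf_eq_zero ha.1.le (smul_nonneg (by norm_num) ha.1.le)
      (sub_nonneg.2 h1) (hay.trans (h ⟨a, ha⟩)) (by rw [inf_comm]; exact h2)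
  have h4 : (1 / 2 : ℝ) • a ≤ 0 := by
    have h5 := sub_nonneg.2 h3
    have h6 : (1 / 2 : ℝ) • a - a = -((1 / 2 : ℝ) • a) := by
      module
    rw [h6] at h5
    exact neg_nonneg.1 h5
  exact ha.1.not_ge (h3.trans h4)

theorem orderConvergesTo_of_atomic {f : F} (hf : 0 ≤ f)
    (hat : ∀ g : F, 0 < g → g ≤ f → ∃ a : F, IsVLAtom a ∧ a ≤ g)
    {C : {a : F // IsVLAtom a} → F → ℝ} (hC : ∀ a, IsCoordAlong a.1 (C a))
    {G : Filter F} {p : F} (hG : Set.Icc (p - f) (p + f) ∈ G)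
    (hGa : ∀ a, Set.Icc (p - ((1 / 2 : ℝ) • a.1 + (f - C a f • a.1)))
      (p + ((1 / 2 : ℝ) • a.1 + (f - C a f • a.1))) ∈ G) :
    OrderConvergesTo G p := by
  set W : Set F := {w | w = f ∨ ∃ a, w = (1 / 2 : ℝ) • a.1 + (f - C a f • a.1)}
  have hW : ∀ w ∈ W, 0 ≤ w ∧ Set.Icc (p - w) (p + w) ∈ G := by
    rintro w (rfl | ⟨a, rfl⟩)
    · exact ⟨hf, hG⟩
    · exact ⟨add_nonneg (smul_nonneg (by norm_num) a.2.1.le)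
        (sub_nonneg.2 (hC a f hf).2.1), hGa a⟩
  refine ⟨{q | ∃ w ∈ W, q = (p - w, p + w)}, ?_, ?_, ?_⟩
  · rintro _ ⟨w, hw, rfl⟩
    exact (sub_le_self p (hW w hw).1).trans (le_add_of_nonneg_right (hW w hw).1)
  · rintro _ ⟨w, hw, rfl⟩
    exact (hW w hw).2
  · ext z
    simp only [Set.mem_iInter, Set.mem_singleton_iff]
    constructor
    · intro hz
      have hzw : ∀ w ∈ W, |z - p| ≤ w := fun w hw => by
        obtain ⟨h1, h2⟩ := hz _ ⟨w, hw, rfl⟩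
        refine sup_le (sub_le_iff_le_add'.2 h2) ?_
        rw [neg_sub]
        exact sub_le_comm.1 h1
      have h0 : |z - p| = 0 := eq_zero_of_forall_atom_le hat hC (abs_nonneg _)
        (hzw f (Or.inl rfl)) fun a => hzw _ (Or.inr ⟨a, rfl⟩)
      have h1 := le_abs_self (z - p)
      have h2 := neg_le_abs (z - p)
      rw [h0] at h1 h2
      exact sub_eq_zero.1 (le_antisymm h1 (neg_nonpos.1 h2))
    · rintro rfl _ ⟨w, hw, rfl⟩
      exact ⟨sub_le_self _ (hW w hw).1, le_add_of_nonneg_right (hW w hw).1⟩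

theorem orderPreCompact_Icc_of_atomic
    (harch : ∀ x y : F, 0 ≤ x → (∀ n : ℕ, n • x ≤ y) → x = 0) {f : F} (hf : 0 ≤ f)
    (hat : ∀ g : F, 0 < g → g ≤ f → ∃ a : F, IsVLAtom a ∧ a ≤ g) :
    OrderPreCompact (Set.Icc (0 : F) f) := by
  intro U hU
  choose C hC using fun a : {a : F // IsVLAtom a} => a.2.exists_isCoordAlong harch
  have hprod : ∀ {A : Set F} {w : F}, A ∈ U → (∀ x ∈ A, ∀ y ∈ A, x - y ≤ w) →
      Set.Icc (0 - w) (0 + w) ∈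
        Filter.map (fun q : F × F => q.1 - q.2) ((U : Filter F) ×ˢ (U : Filter F)) := by
    intro A w hA h
    refine Filter.mem_map.2 (Filter.mem_of_superset (Filter.prod_mem_prod hA hA) ?_)
    rintro ⟨x, y⟩ ⟨hx, hy⟩
    refine ⟨?_, by simpa using h x hx y hy⟩
    rw [zero_sub]
    exact neg_le.1 (by simpa using h y hy x hx)
  refine orderConvergesTo_of_atomic hf hat hC
    (hprod hU fun x hx y hy => (sub_le_self x hy.1).trans hx.2) fun a => ?_
  have hI : C a ⁻¹' Set.Icc 0 (C a f) ∈ U := Filter.mem_of_superset hU fun x hx =>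
    ⟨(hC a x hx.1).1, (hC a).mono a.2.1 hx.1 hx.2⟩
  obtain ⟨γ, -, hγ⟩ := (isCompact_Icc (a := (0 : ℝ)) (b := C a f)).ultrafilter_le_nhds
    (U.map (C a)) (Filter.le_principal_iff.2 hI)
  have hA : C a ⁻¹' Metric.ball γ (1 / 4) ∈ U :=
    hγ (Metric.ball_mem_nhds γ (by norm_num))
  refine hprod (Filter.inter_mem hU hA) ?_
  rintro x ⟨hx, hxγ⟩ y ⟨hy, hyγ⟩
  refine (hC a).sub_le a.2.1.le hx.1 hx.2 hy.1 ?_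
  simp only [Set.mem_preimage, Metric.mem_ball, Real.dist_eq, abs_lt] at hxγ hyγ
  linarith [hxγ.2, hyγ.1]

theorem OrderConvergesTo.exists_coord_lt
    {a : F} (ha : 0 < a) {c : F → ℝ} (hc : IsCoordAlong a c)
    {G : Filter F} {p : F} (hp : 0 ≤ p) (h : OrderConvergesTo G p) {ε : ℝ} (hε : 0 < ε) :
    ∀ᶠ x in G, 0 ≤ x → |c x - c p| < ε := by
  obtain ⟨S, -, hSG, hS⟩ := h
  have hpS : ∀ q ∈ S, p ∈ Set.Icc q.1 q.2 := by
    have : p ∈ ⋂ q ∈ S, Set.Icc q.1 q.2 := hS ▸ rfl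
    simpa only [Set.mem_iInter] using this
  have hSp : ∀ z, (∀ q ∈ S, z ∈ Set.Icc q.1 q.2) → z = p := fun z hz => by
    have : z ∈ ⋂ q ∈ S, Set.Icc q.1 q.2 := by simpa only [Set.mem_iInter] using hz
    rwa [hS] at this
  have hεa : 0 ≤ ε • a := smul_nonneg hε.le ha.le
  have hne : ε • a ≠ 0 := smul_ne_zero hε.ne' ha.ne'
  have hv : ∃ q ∈ S, c q.2 < c p + ε := by
    by_contra! H
    refine hne (add_eq_left.1 (hSp (p + ε • a) fun q hq => ⟨?_, ?_⟩))
    · exact (hpS q hq).1.trans (le_add_of_nonneg_right hεa)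
    · exact hc.add_smul_le ha.le hp (hpS q hq).2 (H q hq)
  have hu : ∃ q ∈ S, c p - ε < c (q.1 ⊔ 0) := by
    by_contra! H
    refine hne (sub_eq_self.1 (hSp (p - ε • a) fun q hq => ⟨?_, ?_⟩))
    · refine le_sup_left.trans (le_sub_iff_add_le.2 (hc.add_smul_le ha.le le_sup_right
        (sup_le (hpS q hq).1 hp) ?_))
      linarith [H q hq]
    · exact (sub_le_self p hεa).trans (hpS q hq).2
  obtain ⟨q, hq, hcq⟩ := hv
  obtain ⟨r, hr, hcr⟩ := hu
  filter_upwards [hSG q hq, hSG r hr] with x hxq hxr hx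
  have h1 := hc.mono ha hx hxq.2
  have h2 := hc.mono ha le_sup_right (sup_le hxr.1 hx)
  rw [abs_lt]
  constructor <;> linarith

theorem exists_topology_of_atomic
    (harch : ∀ x y : F, 0 ≤ x → (∀ n : ℕ, n • x ≤ y) → x = 0) {f : F} (hf : 0 ≤ f)
    (hat : ∀ g : F, 0 < g → g ≤ f → ∃ a : F, IsVLAtom a ∧ a ≤ g) :
    ∃ τ : TopologicalSpace (Set.Icc (0 : F) f),
      ∀ G : Filter F, Set.Icc (0 : F) f ∈ G →
        ∀ p : Set.Icc (0 : F) f,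
          (OrderConvergesTo G (p : F) ↔
            Filter.comap (Subtype.val : Set.Icc (0 : F) f → F) G ≤ @nhds _ τ p) := by
  choose C hC using fun a : {a : F // IsVLAtom a} => a.2.exists_isCoordAlong harch
  refine ⟨TopologicalSpace.induced (fun x a => C a x.1) inferInstance, fun G hG p => ?_⟩
  rw [nhds_induced, ← Filter.tendsto_iff_comap, tendsto_pi_nhds]
  constructor
  · intro h a
    rw [Metric.tendsto_nhds]
    intro ε hε
    rw [Filter.eventually_comap]
    filter_upwards [h.exists_coord_lt a.2.1 (hC a) p.2.1 hε] with x hx y hy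
    rw [Real.dist_eq, hy]
    exact hx (hy ▸ y.2.1)
  · intro h
    have hmem : ∀ {w : F} {P : F → Prop}, (∀ᶠ x in G, P x) →
        (∀ x ∈ Set.Icc (0 : F) f, P x → x - p ≤ w ∧ p - x ≤ w) →
        Set.Icc ((p : F) - w) (p + w) ∈ G := by
      intro w P hP hw
      filter_upwards [hG, hP] with x hx hPx
      exact ⟨sub_le_comm.1 (hw x hx hPx).2, sub_le_iff_le_add'.1 (hw x hx hPx).1⟩
    refine orderConvergesTo_of_atomic hf hat hC (hmem hG fun x _ hx =>
      ⟨(sub_le_self x p.2.1).trans hx.2, (sub_le_self _ hx.1).trans p.2.2⟩) fun a => ?_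
    have ha := Metric.tendsto_nhds.1 (h a) (1 / 2) (by norm_num)
    rw [Filter.eventually_comap] at ha
    refine hmem ha fun x hx hPx => ?_
    have hd := hPx ⟨x, hx⟩ rfl
    rw [Real.dist_eq, abs_lt] at hd
    exact ⟨(hC a).sub_le a.2.1.le hx.1 hx.2 p.2.1 (by linarith [hd.2]),
      (hC a).sub_le a.2.1.le p.2.1 p.2.2 hx.1 (by linarith [hd.1])⟩

/-- An interval below an atomless element is not a finite union of sets whose differences
are bounded by elements not dominating `g`. -/
theorem exists_mem_sInter_of_atomless
    (harch : ∀ x y : F, 0 ≤ x → (∀ n : ℕ, n • x ≤ y) → x = 0) {f g : F} (hg : 0 < g)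
    (hgf : g ≤ f) (hna : ∀ a, IsVLAtom a → ¬ a ≤ g) (T : Finset (Set F))
    (hT : ∀ B ∈ T, ∃ w, 0 ≤ w ∧ ¬ g ≤ w ∧
      ∀ x ∈ Set.Icc 0 f \ B, ∀ y ∈ Set.Icc 0 f \ B, x - y ≤ w) :
    (⋂₀ (T : Set (Set F))).Nonempty := by
  classical
  choose! w hw0 hgw hw using hT
  obtain ⟨k, hk, hkd⟩ := exists_pairwise_disjoint_le harch hna T (fun B => (g - w B)⁺)
    (fun B hB => lt_of_le_of_ne (posPart_nonneg _) fun H => hgw B hB (by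
      rwa [eq_comm, posPart_eq_zero, sub_nonpos] at H))
    (fun B hB => sup_le (sub_le_self g (hw0 B hB)) hg.le)
  choose! N hN using fun B (hB : B ∈ T) =>
    exists_nsmul_inf_not_le harch hg.le (hk B hB).1 (hk B hB).2
  set p : Set F → F := fun B => N B • k B ⊓ g
  have hp0 : ∀ B ∈ T, 0 ≤ p B := fun B hB => le_inf (nsmul_nonneg (hk B hB).1.le _) hg.le
  have hpd : ∀ A ∈ T, ∀ B ∈ T, A ≠ B → p A ⊓ p B = 0 := fun A hA B hB hAB => by
    have hA0 := (hk A hA).1.le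
    have hB0 := (hk B hB).1.le
    refine inf_eq_zero_of_le (hp0 A hA) (hp0 B hB) inf_le_left inf_le_left
      (inf_nsmul_eq_zero (nsmul_nonneg hA0 _) hB0 ?_ _)
    rw [inf_comm]
    exact inf_nsmul_eq_zero hB0 hA0 (hkd B hB A hA hAB.symm) _
  have hsum : ∀ τ ⊆ T, ∑ A ∈ τ, p A ∈ Set.Icc 0 f := fun τ hτ =>
    ⟨Finset.sum_nonneg fun A hA => hp0 A (hτ hA),
      (sum_le_of_pairwise_disjoint hg.le τ (fun A hA => hp0 A (hτ hA)) (fun A _ => inf_le_right)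
        fun A hA B hB => hpd A (hτ hA) B (hτ hB)).trans hgf⟩
  set σ := T.filter fun B => ¬ ∃ τ ⊆ T, B ∈ τ ∧ ∑ A ∈ τ, p A ∉ B
  have hσ : σ ⊆ T := Finset.filter_subset _ _
  refine ⟨∑ A ∈ σ, p A, fun B hB => ?_⟩
  have hB : B ∈ T := hB
  by_contra hnot
  by_cases hBσ : B ∈ σ
  · exact (Finset.mem_filter.1 hBσ).2 ⟨σ, hσ, hBσ, hnot⟩
  · obtain ⟨τ, hτ, hBτ, hτB⟩ : ∃ τ ⊆ T, B ∈ τ ∧ ∑ A ∈ τ, p A ∉ B := by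
      by_contra H
      exact hBσ (Finset.mem_filter.2 ⟨hB, H⟩)
    have h1 := hw B hB _ ⟨hsum τ hτ, hτB⟩ _ ⟨hsum σ hσ, hnot⟩
    have h2 : p B ≤ ∑ A ∈ τ, p A :=
      Finset.single_le_sum (f := p) (fun A hA => hp0 A (hτ hA)) hBτ
    refine hN B hB (le_of_le_add_of_inf_eq_zero (hp0 B hB) (hw0 B hB) (hsum σ hσ).1
      (h2.trans (sub_le_iff_le_add.1 h1)) ?_)
    exact inf_sum_eq_zero (hp0 B hB) σ (fun A hA => hp0 A (hσ hA)) fun A hA =>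
      hpd B hB A (hσ hA) fun H => hBσ (H ▸ hA)

theorem atomic_of_orderPreCompact_Icc
    (harch : ∀ x y : F, 0 ≤ x → (∀ n : ℕ, n • x ≤ y) → x = 0) {f : F}
    (h : OrderPreCompact (Set.Icc (0 : F) f)) :
    ∀ g : F, 0 < g → g ≤ f → ∃ a : F, IsVLAtom a ∧ a ≤ g := by
  intro g hg hgf
  by_contra! hna
  obtain ⟨U, hU⟩ := Ultrafilter.exists_ultrafilter_of_finite_inter_nonempty
    {B : Set F | ∃ w, 0 ≤ w ∧ ¬ g ≤ w ∧
      ∀ x ∈ Set.Icc 0 f \ B, ∀ y ∈ Set.Icc 0 f \ B, x - y ≤ w}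
    fun T hT => exists_mem_sInter_of_atomless harch hg hgf hna T hT
  have hfU : Set.Icc 0 f ∈ U := hU ⟨0, le_rfl, hg.not_ge, by simp⟩
  obtain ⟨S, -, hSG, hS⟩ := h U hfU
  have h0S : ∀ q ∈ S, (0 : F) ∈ Set.Icc q.1 q.2 := by
    have : (0 : F) ∈ ⋂ q ∈ S, Set.Icc q.1 q.2 := hS ▸ rfl
    simpa only [Set.mem_iInter] using this
  have hgS : g ∈ ⋂ q ∈ S, Set.Icc q.1 q.2 := by
    simp only [Set.mem_iInter]
    refine fun q hq => ⟨(h0S q hq).1.trans hg.le, ?_⟩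
    by_contra hgq
    obtain ⟨A, hA, hAq⟩ := Filter.mem_prod_same_iff.1 (Filter.mem_map.1 (hSG q hq))
    have hAc : Aᶜ ∈ U := hU ⟨q.2, (h0S q hq).2, hgq, fun x hx y hy =>
      (hAq (Set.mk_mem_prod (not_not.1 hx.2) (not_not.1 hy.2))).2⟩
    exact U.compl_mem_iff_notMem.1 hAc hA
  rw [hS] at hgS
  exact hg.ne' hgS

theorem atomic_of_topological
    (harch : ∀ x y : F, 0 ≤ x → (∀ n : ℕ, n • x ≤ y) → x = 0) {f : F} (hf : 0 ≤ f)
    (h : ∃ τ : TopologicalSpace (Set.Icc (0 : F) f),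
      ∀ G : Filter F, Set.Icc (0 : F) f ∈ G →
        ∀ p : Set.Icc (0 : F) f,
          (OrderConvergesTo G (p : F) ↔
            Filter.comap (Subtype.val : Set.Icc (0 : F) f → F) G ≤ @nhds _ τ p)) :
    ∀ g : F, 0 < g → g ≤ f → ∃ a : F, IsVLAtom a ∧ a ≤ g := by
  intro g hg hgf
  by_contra! hna
  obtain ⟨τ, hτ⟩ := h
  let o : Set.Icc (0 : F) f := ⟨0, le_rfl, hf⟩
  obtain ⟨S, -, hSG, hS⟩ := (hτ (Filter.map Subtype.val (@nhds _ τ o))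
    (Filter.mem_map.2 (Filter.mem_of_superset Filter.univ_mem fun x _ => x.2)) o).2
    (by rw [Filter.comap_map Subtype.val_injective])
  have h0S : ∀ q ∈ S, (0 : F) ∈ Set.Icc q.1 q.2 := by
    have : (0 : F) ∈ ⋂ q ∈ S, Set.Icc q.1 q.2 := hS ▸ rfl
    simpa only [Set.mem_iInter] using this
  obtain ⟨q, hq, hgq⟩ : ∃ q ∈ S, ¬ g ≤ q.2 := by
    by_contra! H
    have hgS : g ∈ ⋂ q ∈ S, Set.Icc q.1 q.2 := by
      simp only [Set.mem_iInter]
      exact fun q hq => ⟨(h0S q hq).1.trans hg.le, H q hq⟩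
    rw [hS] at hgS
    exact hg.ne' hgS
  have hpos : 0 < (g - q.2)⁺ := lt_of_le_of_ne (posPart_nonneg _) fun H => hgq (by
    rwa [eq_comm, posPart_eq_zero, sub_nonpos] at H)
  have hle : (g - q.2)⁺ ≤ g := sup_le (sub_le_self g (h0S q hq).2) hg.le
  obtain ⟨k, hk, hkd⟩ := exists_seq_disjoint_le harch hpos fun a ha H => hna a ha (H.trans hle)
  choose N hN using fun n => exists_nsmul_inf_not_le harch hg.le (hk n).1 (hk n).2
  have hp0 : ∀ n, 0 ≤ N n • k n ⊓ g := fun n => le_inf (nsmul_nonneg (hk n).1.le _) hg.le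
  have hconv := orderConvergesTo_zero_of_disjoint_seq harch hp0 (fun _ => inf_le_right)
    fun i j hij => by
      refine inf_eq_zero_of_le (hp0 i) (hp0 j) inf_le_left inf_le_left
        (inf_nsmul_eq_zero (nsmul_nonneg (hk i).1.le _) (hk j).1.le ?_ _)
      rw [inf_comm]
      exact inf_nsmul_eq_zero (hk j).1.le (hk i).1.le (hkd j i hij.symm) _
  have hmem := (hτ _ (Filter.mem_map.2 (Filter.mem_of_superset Filter.univ_mem fun n _ =>
    ⟨hp0 n, inf_le_right.trans hgf⟩)) o).1 hconv (Filter.mem_map.1 (hSG q hq))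
  obtain ⟨t, ht, htq⟩ := Filter.mem_comap.1 hmem
  obtain ⟨n, hn⟩ := (Filter.mem_map.1 ht |> Filter.nonempty_of_mem)
  exact hN n (htq (a := ⟨_, hp0 n, inf_le_right.trans hgf⟩) hn).2

end VectorLattice

/-- In an Archimedean vector lattice, for `0 ≤ f` the following are
equivalent: `f` lies in the atomic part; `[0, f]` is order pre-compact; order convergence
on `[0, f]` is topological. -/
theorem interval_atomicPart_iff_orderPreCompact_iff_topological
    {F : Type*} [Lattice F] [AddCommGroup F] [Module ℝ F]
    (hadd : ∀ x y z : F, x ≤ y → x + z ≤ y + z)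
    (hsmul : ∀ (t : ℝ) (x : F), 0 ≤ t → 0 ≤ x → 0 ≤ t • x)
    (harch : ∀ x y : F, (∀ n : ℕ, 0 ≤ n • x ∧ n • x ≤ y) → x = 0)
    (f : F) (hf : 0 ≤ f) :
    List.TFAE
      [∀ g : F, 0 < g → g ≤ f → ∃ a : F, IsVLAtom a ∧ a ≤ g,
       OrderPreCompact (Set.Icc (0 : F) f),
       ∃ τ : TopologicalSpace (Set.Icc (0 : F) f),
         ∀ G : Filter F, Set.Icc (0 : F) f ∈ G →
           ∀ p : Set.Icc (0 : F) f,
             (OrderConvergesTo G (p : F) ↔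
               Filter.comap (Subtype.val : Set.Icc (0 : F) f → F) G ≤ @nhds _ τ p)] := by
  have : IsOrderedAddMonoid F := { add_le_add_left := fun x y h z => hadd x y z h }
  have : PosSMulMono ℝ F := .of_smul_nonneg fun t ht x hx => hsmul t x ht hx
  have harch' : ∀ x y : F, 0 ≤ x → (∀ n : ℕ, n • x ≤ y) → x = 0 := fun x y hx h =>
    harch x y fun n => ⟨nsmul_nonneg hx n, h n⟩
  tfae_have 1 → 2 := orderPreCompact_Icc_of_atomic harch' hf
  tfae_have 2 → 1 := atomic_of_orderPreCompact_Icc harch'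
  tfae_have 1 → 3 := exists_topology_of_atomic harch' hf
  tfae_have 3 → 1 := atomic_of_topological harch' hf
  tfae_finish
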